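/- Let X be a set, R a binary relation on X, and κ an ordinal. If for every ordinal δ < κ, every R-chain of length δ has an upper bound, then there exists an R-chain of length κ. (In particular, DC_κ holds for relations on any set.) -/

import Mathlib

universe u

/-- `c` is an `R`-chain of length `δ`: a function from the ordinals below `δ` to `X`
which is increasing with respect to `R`. -/
def IsRChain {X : Type u} (R : X → X → Prop) (δ : Ordinal.{u})
    (c : Set.Iio δ → X) : Prop :=
  ∀ α β : Set.Iio δ, (α : Ordinal) < (β : Ordinal) → R (c α) (c β)

/-- `b` is an upper bound of the chain `c`. -/
def IsChainUB {X : Type u} (R : X → X → Prop) {δ : Ordinal.{u}}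
    (c : Set.Iio δ → X) (b : X) : Prop :=
  ∀ α : Set.Iio δ, R (c α) b

/-- The transfinite sequence which picks at each stage an upper bound of all earlier values,
whenever there is one. -/
noncomputable def greedyChain {X : Type u} [Nonempty X] (R : X → X → Prop) :
    Ordinal.{u} → X :=
  WellFounded.fix Ordinal.lt_wf fun δ f => Classical.epsilon fun b => ∀ α (hα : α < δ), R (f α hα) b

theorem greedyChain_spec {X : Type u} [Nonempty X] (R : X → X → Prop) (δ : Ordinal.{u})
    (hδ : ∃ b, ∀ α < δ, R (greedyChain R α) b) :
    ∀ α < δ, R (greedyChain R α) (greedyChain R δ) := by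
  have h := Classical.epsilon_spec hδ
  have heq : greedyChain R δ = Classical.epsilon fun b => ∀ α < δ, R (greedyChain R α) b :=
    WellFounded.fix_eq _ _ _
  rwa [← heq] at h

/-- `DC_κ` holds for relations on any set: if every `R`-chain of length `< κ` has an
upper bound, then there is an `R`-chain of length `κ`. -/
theorem dependent_choice_kappa {X : Type u} (R : X → X → Prop) (κ : Ordinal.{u})
    (h : ∀ δ : Ordinal.{u}, δ < κ → ∀ c : Set.Iio δ → X, IsRChain R δ c →
      ∃ b : X, IsChainUB R c b) :
    ∃ c : Set.Iio κ → X, IsRChain R κ c := by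
  rcases eq_or_ne κ 0 with rfl | hκ
  · exact ⟨fun α => (not_lt_zero (Set.mem_Iio.1 α.2)).elim, fun α => (not_lt_zero (Set.mem_Iio.1 α.2)).elim⟩
  have : Nonempty X := by
    obtain ⟨b, -⟩ := h 0 (pos_iff_ne_zero.2 hκ) (fun α => (not_lt_zero (Set.mem_Iio.1 α.2)).elim)
      fun α => (not_lt_zero (Set.mem_Iio.1 α.2)).elim
    exact ⟨b⟩
  have key : ∀ β < κ, ∀ α < β, R (greedyChain R α) (greedyChain R β) := by
    intro β
    induction β using WellFoundedLT.induction with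
    | ind β ih =>
      intro hβ
      obtain ⟨b, hb⟩ := h β hβ (fun α => greedyChain R α)
        fun α γ hαγ => ih γ γ.2 (γ.2.trans hβ) α hαγ
      exact greedyChain_spec R β ⟨b, fun α hα => hb ⟨α, hα⟩⟩
  exact ⟨fun α => greedyChain R α, fun α β hαβ => key β β.2 α hαβ⟩
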